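/- Existence for the regularized 2-1 junction: for every choice of initial data φ^1, φ^2, φ^3 ∈ B, continuous boundary data f̄^1, f̄^2 : [0,T] → B and Φ̄^3 : [0,T] → [0,1], regularization H_ε, threshold 0 < p ≤ v_2, flux limiter Φ and table of games as in the assumptions, there exists a mild kinetic solution F = (f^1,f^2,f^3) : [0,T] → B^3 across the regularized 2-1 junction. -/

import Mathlib

open Set

noncomputable def rhoF {n : ℕ} (f : Fin n → ℝ) : ℝ := ∑ j, f j

noncomputable def fluxF {n : ℕ} (v f : Fin n → ℝ) : ℝ := ∑ j, v j * f j

noncomputable def gainF {n : ℕ} (η0 : ℝ) (A : Fin n → Fin n → Fin n → ℝ → ℝ)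
    (j : Fin n) (f : Fin n → ℝ) : ℝ :=
  η0 * rhoF f * ∑ h, ∑ k, A h k j (rhoF f) * f h * f k

noncomputable def lossF {n : ℕ} (η0 : ℝ) (f : Fin n → ℝ) : ℝ := η0 * (rhoF f) ^ 2

def admissibleF {n : ℕ} (f : Fin n → ℝ) : Prop :=
  (∀ j, 0 ≤ f j ∧ f j ≤ 1) ∧ rhoF f ≤ 1

noncomputable def deltaC {n : ℕ} (j : Fin n) : ℝ := if (j : ℕ) = 0 then 0 else 1

def IsSpeedLattice {n : ℕ} (hn : 2 ≤ n) (v : Fin n → ℝ) : Prop :=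
  StrictMono v ∧ v ⟨0, by omega⟩ = 0 ∧ v ⟨n - 1, by omega⟩ = 1

def IsFluxLimiter (Φ : ℝ → ℝ → ℝ) : Prop :=
  (∀ u ∈ Icc (0:ℝ) 1, ∀ w ∈ Icc (0:ℝ) 1, Φ u w ∈ Icc (0:ℝ) 1) ∧
  (∀ u ∈ Icc (0:ℝ) 1, ∀ w ∈ Icc (0:ℝ) 1, 1 < u + w → Φ u w * u ≤ 1 - w) ∧
  (∃ K : ℝ, 0 < K ∧ ∀ u₁ ∈ Icc (0:ℝ) 1, ∀ w₁ ∈ Icc (0:ℝ) 1, ∀ u₂ ∈ Icc (0:ℝ) 1,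
    ∀ w₂ ∈ Icc (0:ℝ) 1, |Φ u₂ w₂ - Φ u₁ w₁| ≤ K * (|u₂ - u₁| + |w₂ - w₁|))

def IsTableOfGames {n : ℕ} (A : Fin n → Fin n → Fin n → ℝ → ℝ) : Prop :=
  (∀ h k j : Fin n, ∀ u ∈ Icc (0:ℝ) 1, A h k j u ∈ Icc (0:ℝ) 1) ∧
  (∀ h k : Fin n, ∀ u ∈ Icc (0:ℝ) 1, ∑ j, A h k j u = 1) ∧
  (∀ h k j : Fin n, ∃ K : ℝ, 0 < K ∧ ∀ u ∈ Icc (0:ℝ) 1, ∀ w ∈ Icc (0:ℝ) 1,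
    |A h k j u - A h k j w| ≤ K * |u - w|)

def IsRegularizer (ε : ℝ) (H : ℝ → ℝ) : Prop :=
  (∀ x : ℝ, H x ∈ Icc (0:ℝ) 1) ∧ (∀ x : ℝ, x ≤ 0 → H x = 0) ∧ (∀ x : ℝ, ε ≤ x → H x = 1) ∧
  ∃ K : ℝ, 0 < K ∧ ∀ x y : ℝ, |H x - H y| ≤ K * |x - y|

noncomputable def hcoef {n : ℕ} (v : Fin n → ℝ) (H : ℝ → ℝ) (p : ℝ)
    (f1 f2 : ℝ → Fin n → ℝ) (s : ℝ) : ℝ :=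
  H (p - (fluxF v (f1 s) + fluxF v (f2 s)))

noncomputable def phi301 {n : ℕ} (v : Fin n → ℝ) (Φ : ℝ → ℝ → ℝ) (H : ℝ → ℝ) (p : ℝ)
    (f1 f2 f3 : ℝ → Fin n → ℝ) (s : ℝ) : ℝ :=
  Φ (∑ k, deltaC k * (f1 s k + hcoef v H p f1 f2 s * f2 s k)) (rhoF (f3 s))

noncomputable def rhs21_1 {n : ℕ} (v : Fin n → ℝ) (η0 : ℝ) (A : Fin n → Fin n → Fin n → ℝ → ℝ)
    (Φ : ℝ → ℝ → ℝ) (H : ℝ → ℝ) (p : ℝ) (fbar1 f1 f2 f3 : ℝ → Fin n → ℝ)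
    (j : Fin n) (s : ℝ) : ℝ :=
  v j * (Φ (∑ k, fbar1 s k) (rhoF (f1 s)) * fbar1 s j - phi301 v Φ H p f1 f2 f3 s * f1 s j)
  + gainF η0 A j (f1 s) - f1 s j * lossF η0 (f1 s)

noncomputable def rhs21_2 {n : ℕ} (v : Fin n → ℝ) (η0 : ℝ) (A : Fin n → Fin n → Fin n → ℝ → ℝ)
    (Φ : ℝ → ℝ → ℝ) (H : ℝ → ℝ) (p : ℝ) (fbar2 f1 f2 f3 : ℝ → Fin n → ℝ)
    (j : Fin n) (s : ℝ) : ℝ :=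
  v j * (Φ (∑ k, fbar2 s k) (rhoF (f2 s)) * fbar2 s j
    - hcoef v H p f1 f2 s * phi301 v Φ H p f1 f2 f3 s * f2 s j)
  + gainF η0 A j (f2 s) - f2 s j * lossF η0 (f2 s)

noncomputable def rhs21_3 {n : ℕ} (v : Fin n → ℝ) (η0 : ℝ) (A : Fin n → Fin n → Fin n → ℝ → ℝ)
    (Φ : ℝ → ℝ → ℝ) (H : ℝ → ℝ) (p : ℝ) (Φbar3 : ℝ → ℝ) (f1 f2 f3 : ℝ → Fin n → ℝ)
    (j : Fin n) (s : ℝ) : ℝ :=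
  v j * (phi301 v Φ H p f1 f2 f3 s * (f1 s j + hcoef v H p f1 f2 s * f2 s j) * deltaC j
    - Φbar3 s * f3 s j)
  + gainF η0 A j (f3 s) - f3 s j * lossF η0 (f3 s)

def IsMildSol21 {n : ℕ} (v : Fin n → ℝ) (η0 : ℝ) (A : Fin n → Fin n → Fin n → ℝ → ℝ)
    (Φ : ℝ → ℝ → ℝ) (H : ℝ → ℝ) (p T : ℝ) (φ1 φ2 φ3 : Fin n → ℝ)
    (fbar1 fbar2 : ℝ → Fin n → ℝ) (Φbar3 : ℝ → ℝ) (f1 f2 f3 : ℝ → Fin n → ℝ) : Prop :=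
  ContinuousOn f1 (Icc 0 T) ∧ ContinuousOn f2 (Icc 0 T) ∧ ContinuousOn f3 (Icc 0 T) ∧
  (∀ t ∈ Icc (0:ℝ) T, admissibleF (f1 t) ∧ admissibleF (f2 t) ∧ admissibleF (f3 t)) ∧
  (∀ t ∈ Icc (0:ℝ) T, ∀ j : Fin n,
    f1 t j = φ1 j + ∫ s in (0:ℝ)..t, rhs21_1 v η0 A Φ H p fbar1 f1 f2 f3 j s) ∧
  (∀ t ∈ Icc (0:ℝ) T, ∀ j : Fin n,
    f2 t j = φ2 j + ∫ s in (0:ℝ)..t, rhs21_2 v η0 A Φ H p fbar2 f1 f2 f3 j s) ∧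
  (∀ t ∈ Icc (0:ℝ) T, ∀ j : Fin n,
    f3 t j = φ3 j + ∫ s in (0:ℝ)..t, rhs21_3 v η0 A Φ H p Φbar3 f1 f2 f3 j s)

def GoodData21 {n : ℕ} (T : ℝ) (φ1 φ2 φ3 : Fin n → ℝ) (fbar1 fbar2 : ℝ → Fin n → ℝ)
    (Φbar3 : ℝ → ℝ) : Prop :=
  admissibleF φ1 ∧ admissibleF φ2 ∧ admissibleF φ3 ∧
  ContinuousOn fbar1 (Icc 0 T) ∧ (∀ t ∈ Icc (0:ℝ) T, admissibleF (fbar1 t)) ∧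
  ContinuousOn fbar2 (Icc 0 T) ∧ (∀ t ∈ Icc (0:ℝ) T, admissibleF (fbar2 t)) ∧
  ContinuousOn Φbar3 (Icc 0 T) ∧ (∀ t ∈ Icc (0:ℝ) T, Φbar3 t ∈ Icc (0:ℝ) 1)

/-- The solution at time `t` of `u' = l • (q - u)`, `u 0 = φ`. -/
noncomputable def relaxation {E : Type*} [NormedAddCommGroup E] [NormedSpace ℝ E]
    (l : ℝ) (φ : E) (q : ℝ → E) (t : ℝ) : E :=
  Real.exp (-(l * t)) • (φ + ∫ s in (0:ℝ)..t, (l * Real.exp (l * s)) • q s)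

theorem integral_exp_const_mul {c : ℝ} (hc : c ≠ 0) (t : ℝ) :
    ∫ s in (0:ℝ)..t, Real.exp (c * s) = (Real.exp (c * t) - 1) / c := by
  have h : ∀ s ∈ uIcc 0 t, HasDerivAt (fun s => Real.exp (c * s) / c) (Real.exp (c * s)) s := by
    intro s _
    have h1 := (((hasDerivAt_id s).const_mul c).exp).div_const c
    simpa [mul_div_assoc, div_self hc] using h1
  rw [intervalIntegral.integral_eq_sub_of_hasDerivAt h
    (Continuous.intervalIntegrable (by fun_prop) _ _)]
  simp [sub_div]

section Relaxation

variable {E : Type*} [NormedAddCommGroup E] [NormedSpace ℝ E]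

theorem hasDerivAt_relaxation [CompleteSpace E] (l : ℝ) (φ : E) {q : ℝ → E} (hq : Continuous q)
    (t : ℝ) :
    HasDerivAt (relaxation l φ q) (l • (q t - relaxation l φ q t)) t := by
  have hc : Continuous fun s => (l * Real.exp (l * s)) • q s := by fun_prop
  have h1 : HasDerivAt (fun t => φ + ∫ s in (0:ℝ)..t, (l * Real.exp (l * s)) • q s)
      ((l * Real.exp (l * t)) • q t) t :=
    (intervalIntegral.integral_hasDerivAt_right (hc.intervalIntegrable _ _)
      (hc.stronglyMeasurableAtFilter _ _) hc.continuousAt).const_add φ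
  have h2 : HasDerivAt (fun t => Real.exp (-(l * t))) (Real.exp (-(l * t)) * (-l)) t := by
    simpa using (((hasDerivAt_id t).const_mul l).neg).exp
  have h3 := h2.smul h1
  refine h3.congr_deriv ?_
  have h4 : Real.exp (-(l * t)) * Real.exp (l * t) = 1 := by
    rw [← Real.exp_add]; simp
  have h5 : Real.exp (-(l * t)) * (l * Real.exp (l * t)) = l := by
    rw [mul_left_comm, h4, mul_one]
  rw [smul_smul, h5]
  simp only [relaxation]
  rw [smul_sub, smul_smul, mul_neg, neg_smul, mul_comm l (Real.exp _), sub_eq_add_neg]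

theorem continuous_relaxation [CompleteSpace E] (l : ℝ) (φ : E) {q : ℝ → E} (hq : Continuous q) :
    Continuous (relaxation l φ q) :=
  continuous_iff_continuousAt.2 fun t => (hasDerivAt_relaxation l φ hq t).continuousAt

theorem relaxation_eq_add_integral [CompleteSpace E] (l : ℝ) (φ : E) {q : ℝ → E}
    (hq : Continuous q) (t : ℝ) :
    relaxation l φ q t = φ + ∫ s in (0:ℝ)..t, l • (q s - relaxation l φ q s) := by
  have hc := continuous_relaxation l φ hq
  rw [intervalIntegral.integral_eq_sub_of_hasDerivAt
    (fun s _ => hasDerivAt_relaxation l φ hq s)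
    (Continuous.intervalIntegrable (by fun_prop) _ _)]
  simp [relaxation]

theorem relaxation_mem [CompleteSpace E] {K : Set E} (hKc : IsClosed K) (hK : Convex ℝ K) {l : ℝ}
    (hl : 0 < l)
    {φ : E} (hφ : φ ∈ K) {q : ℝ → E} (hq : Continuous q) (hqK : ∀ s, q s ∈ K)
    {t : ℝ} (ht : 0 ≤ t) : relaxation l φ q t ∈ K := by
  by_contra hx
  obtain ⟨f, c, hfc, hcx⟩ := geometric_hahn_banach_closed_point hK hKc hx
  refine hcx.not_ge ?_
  have hint : Continuous fun s => (l * Real.exp (l * s)) • q s := by fun_prop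
  have h1 : f (relaxation l φ q t) = Real.exp (-(l * t)) *
      (f φ + ∫ s in (0:ℝ)..t, (l * Real.exp (l * s)) * f (q s)) := by
    simp only [relaxation, map_smul, map_add, smul_eq_mul]
    rw [← f.intervalIntegral_comp_comm (hint.intervalIntegrable _ _)]
    simp
  have h2 : ∫ s in (0:ℝ)..t, (l * Real.exp (l * s)) * f (q s)
      ≤ ∫ s in (0:ℝ)..t, (l * Real.exp (l * s)) * c := by
    refine intervalIntegral.integral_mono_on ht
      (Continuous.intervalIntegrable (by fun_prop) _ _)
      (Continuous.intervalIntegrable (by fun_prop) _ _) fun s _ => ?_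
    exact mul_le_mul_of_nonneg_left (hfc _ (hqK s)).le (by positivity)
  have h3 : ∫ s in (0:ℝ)..t, (l * Real.exp (l * s)) * c = (Real.exp (l * t) - 1) * c := by
    rw [intervalIntegral.integral_mul_const, intervalIntegral.integral_const_mul,
      integral_exp_const_mul hl.ne']
    field_simp
  have h4 : Real.exp (-(l * t)) * Real.exp (l * t) = 1 := by
    rw [← Real.exp_add]; simp
  rw [h1]
  calc _ ≤ Real.exp (-(l * t)) * (c + (Real.exp (l * t) - 1) * c) := by
        gcongr
        · exact (hfc _ hφ).le
        · exact h2.trans h3.le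
    _ = (Real.exp (-(l * t)) * Real.exp (l * t)) * c := by ring
    _ = c := by rw [h4, one_mul]

theorem norm_relaxation_sub_le {l m C t : ℝ} (hl : 0 < l) (hm : 0 ≤ m) (hC : 0 ≤ C) (ht : 0 ≤ t)
    (φ : E) {q r : ℝ → E} (hq : Continuous q) (hr : Continuous r)
    (hqr : ∀ s ∈ Icc 0 t, ‖q s - r s‖ ≤ C * Real.exp (m * s)) :
    ‖relaxation l φ q t - relaxation l φ r t‖ ≤ l * C / (l + m) * Real.exp (m * t) := by
  have hlm : 0 < l + m := by linarith
  have hdiff : relaxation l φ q t - relaxation l φ r t = Real.exp (-(l * t)) •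
      ∫ s in (0:ℝ)..t, (l * Real.exp (l * s)) • (q s - r s) := by
    simp only [relaxation, smul_sub]
    rw [intervalIntegral.integral_sub (Continuous.intervalIntegrable (by fun_prop) _ _)
      (Continuous.intervalIntegrable (by fun_prop) _ _), ← smul_sub, add_sub_add_left_eq_sub]
  have hle : ‖∫ s in (0:ℝ)..t, (l * Real.exp (l * s)) • (q s - r s)‖
      ≤ ∫ s in (0:ℝ)..t, (l * C) * Real.exp ((l + m) * s) := by
    refine (intervalIntegral.norm_integral_le_integral_norm ht).trans ?_
    refine intervalIntegral.integral_mono_on ht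
      (Continuous.intervalIntegrable (by fun_prop) _ _)
      (Continuous.intervalIntegrable (by fun_prop) _ _) fun s hs => ?_
    rw [norm_smul, Real.norm_of_nonneg (by positivity)]
    calc _ ≤ l * Real.exp (l * s) * (C * Real.exp (m * s)) := by
          gcongr; exact hqr s hs
      _ = _ := by rw [add_mul, Real.exp_add]; ring
  rw [intervalIntegral.integral_const_mul, integral_exp_const_mul hlm.ne'] at hle
  rw [hdiff, norm_smul, Real.norm_of_nonneg (Real.exp_pos _).le]
  have h4 : Real.exp (-(l * t)) * Real.exp ((l + m) * t) = Real.exp (m * t) := by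
    rw [← Real.exp_add]; congr 1; ring
  calc _ ≤ Real.exp (-(l * t)) * (l * C * (Real.exp ((l + m) * t) / (l + m))) := by
        gcongr
        refine hle.trans ?_
        gcongr
        linarith
    _ = l * C / (l + m) * (Real.exp (-(l * t)) * Real.exp ((l + m) * t)) := by ring
    _ = _ := by rw [h4]

/-- A nonautonomous equation `u' = l • (G (y t, u) - u)` with `G` Lipschitz and leaving a closed
convex set invariant has a global solution in that set. -/
theorem exists_relaxation_solution [CompleteSpace E] {Y : Type*} [PseudoMetricSpace Y] {K : Set E}
    (hKc : IsClosed K) (hK : Convex ℝ K) {S : Set Y} {G : Y × E → E} {L : NNReal}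
    (hG : LipschitzOnWith L G (S ×ˢ K)) (hmap : ∀ z ∈ S ×ˢ K, G z ∈ K)
    {y : ℝ → Y} (hy : Continuous y) (hyS : ∀ t, y t ∈ S) {φ : E} (hφ : φ ∈ K)
    {l T : ℝ} (hl : 0 < l) (hT : 0 ≤ T) :
    ∃ u : ℝ → E, Continuous u ∧ (∀ t ∈ Icc 0 T, u t ∈ K) ∧
      ∀ t ∈ Icc 0 T, u t = φ + ∫ s in (0:ℝ)..t, l • (G (y s, u s) - u s) := by
  set m : ℝ := l * L with hm
  have hm0 : 0 ≤ m := by positivity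
  have hexp : ∀ t : ℝ, Real.exp (m * t) * Real.exp (-(m * t)) = 1 := fun t => by
    rw [← Real.exp_add]; simp
  let W : Set C(Icc (0:ℝ) T, E) := {w | ∀ t : Icc (0:ℝ) T, Real.exp (m * t) • w t ∈ K}
  have hWc : IsClosed W := by
    simp only [W, ofPred_forall]
    refine isClosed_iInter fun t => hKc.preimage ?_
    exact (continuous_eval_const t).const_smul _
  have : CompleteSpace W := hWc.completeSpace_coe
  have : Nonempty W := ⟨⟨⟨fun t => Real.exp (-(m * t)) • φ, by fun_prop⟩, fun t => by
    simpa [smul_smul, hexp] using hφ⟩⟩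
  let U : W → ℝ → E := fun w s =>
    Real.exp (m * (projIcc 0 T hT s : ℝ)) • w.1 (projIcc 0 T hT s)
  have hUc : ∀ w, Continuous (U w) := fun w => by
    have := w.1.continuous
    have h2 : Continuous (projIcc 0 T hT) := continuous_projIcc
    fun_prop
  have hUK : ∀ w s, U w s ∈ K := fun w s => w.2 _
  let q : W → ℝ → E := fun w s => G (y s, U w s)
  have hqc : ∀ w, Continuous (q w) := fun w =>
    hG.continuousOn.comp_continuous (hy.prodMk (hUc w)) fun s => ⟨hyS s, hUK w s⟩
  have hqK : ∀ w s, q w s ∈ K := fun w s => hmap _ ⟨hyS s, hUK w s⟩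
  let P : W → W := fun w => ⟨⟨fun t => Real.exp (-(m * t)) • relaxation l φ (q w) t, by
      have := continuous_relaxation l φ (hqc w)
      fun_prop⟩, fun t => by
      simpa [smul_smul, hexp] using relaxation_mem hKc hK hl hφ (hqc w) (hqK w) t.2.1⟩
  have hP : ContractingWith (L / (1 + L)) P := by
    refine ⟨?_, LipschitzWith.of_dist_le_mul fun w w' => ?_⟩
    · rw [div_lt_one (by positivity)]
      exact lt_one_add L
    · rw [Subtype.dist_eq, ContinuousMap.dist_le (by positivity)]
      intro t
      have hq' : ∀ s ∈ Icc (0:ℝ) t, ‖q w s - q w' s‖ ≤ (L * dist w w') * Real.exp (m * s) := by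
        intro s hs
        have hsT : s ∈ Icc (0:ℝ) T := ⟨hs.1, hs.2.trans t.2.2⟩
        have h1 := hG.dist_le_mul (y s, U w s) ⟨hyS s, hUK w s⟩ (y s, U w' s)
          ⟨hyS s, hUK w' s⟩
        rw [dist_eq_norm] at h1
        refine h1.trans ?_
        rw [Prod.dist_eq, dist_self, max_eq_right dist_nonneg, mul_assoc]
        gcongr
        simp only [U, projIcc_of_mem hT hsT]
        rw [dist_smul₀, Real.norm_of_nonneg (Real.exp_pos _).le, mul_comm]
        gcongr
        exact ContinuousMap.dist_apply_le_dist _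
      have h2 := norm_relaxation_sub_le hl hm0 (by positivity) t.2.1 φ (hqc w) (hqc w') hq'
      have h3 : dist ((P w).1 t) ((P w').1 t) = Real.exp (-(m * t)) *
          ‖relaxation l φ (q w) t - relaxation l φ (q w') t‖ := by
        simp only [P, ContinuousMap.coe_mk]
        rw [dist_smul₀, Real.norm_of_nonneg (Real.exp_pos _).le, dist_eq_norm]
      rw [h3]
      calc _ ≤ Real.exp (-(m * t)) *
            (l * (L * dist w w') / (l + m) * Real.exp (m * t)) := by gcongr
        _ = l * (L * dist w w') / (l + m) * (Real.exp (m * t) * Real.exp (-(m * t))) := by ring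
        _ = _ := by
          rw [hexp, hm]
          push_cast
          field_simp
  obtain ⟨w, hw⟩ : ∃ w, P w = w := ⟨_, hP.fixedPoint_isFixedPt⟩
  have hfix : ∀ t ∈ Icc 0 T, relaxation l φ (q w) t = U w t := by
    intro t ht
    have h1 : (P w).1 ⟨t, ht⟩ = w.1 ⟨t, ht⟩ := by rw [hw]
    simp only [U, projIcc_of_mem hT ht, ← h1, P, ContinuousMap.coe_mk, smul_smul, hexp, one_smul]
  refine ⟨relaxation l φ (q w), continuous_relaxation l φ (hqc w), fun t ht => ?_,
    fun t ht => ?_⟩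
  · rw [hfix t ht]; exact hUK w t
  · rw [relaxation_eq_add_integral l φ (hqc w) t]
    congr 1
    refine intervalIntegral.integral_congr fun s hs => ?_
    rw [uIcc_of_le ht.1] at hs
    have h1 := hfix s ⟨hs.1, hs.2.trans ht.2⟩
    simp only [q, h1]

end Relaxation

/-- `f` is bounded and Lipschitz on `s`. -/
def BddLipschitzOn {X : Type*} [PseudoMetricSpace X] (s : Set X) (f : X → ℝ) : Prop :=
  ∃ C, 0 ≤ C ∧ (∀ x ∈ s, |f x| ≤ C) ∧ ∀ x ∈ s, ∀ y ∈ s, |f x - f y| ≤ C * dist x y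

namespace BddLipschitzOn

variable {X : Type*} [PseudoMetricSpace X] {s : Set X} {f g : X → ℝ}

theorem of_bounds {C D : ℝ} (h1 : ∀ x ∈ s, |f x| ≤ C)
    (h2 : ∀ x ∈ s, ∀ y ∈ s, |f x - f y| ≤ D * dist x y) : BddLipschitzOn s f := by
  refine ⟨|C| + |D|, by positivity, fun x hx => (h1 x hx).trans ?_,
    fun x hx y hy => (h2 x hx y hy).trans ?_⟩
  · linarith [le_abs_self C, abs_nonneg D]
  · have : D ≤ |C| + |D| := by linarith [le_abs_self D, abs_nonneg C]
    gcongr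

theorem const (c : ℝ) : BddLipschitzOn s fun _ => c :=
  of_bounds (C := |c|) (D := 0) (fun _ _ => le_rfl) (by simp)

theorem add (hf : BddLipschitzOn s f) (hg : BddLipschitzOn s g) :
    BddLipschitzOn s fun x => f x + g x := by
  obtain ⟨C, -, hC1, hC2⟩ := hf
  obtain ⟨D, -, hD1, hD2⟩ := hg
  refine of_bounds (C := C + D) (D := C + D)
    (fun x hx => (abs_add_le _ _).trans (add_le_add (hC1 x hx) (hD1 x hx))) fun x hx y hy => ?_
  rw [add_sub_add_comm, add_mul]
  exact (abs_add_le _ _).trans (add_le_add (hC2 x hx y hy) (hD2 x hx y hy))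

theorem mul (hf : BddLipschitzOn s f) (hg : BddLipschitzOn s g) :
    BddLipschitzOn s fun x => f x * g x := by
  obtain ⟨C, hC, hC1, hC2⟩ := hf
  obtain ⟨D, hD, hD1, hD2⟩ := hg
  refine of_bounds (C := C * D) (D := C * D + C * D) (fun x hx => ?_) fun x hx y hy => ?_
  · rw [abs_mul]
    exact mul_le_mul (hC1 x hx) (hD1 x hx) (abs_nonneg _) hC
  · rw [show f x * g x - f y * g y = f x * (g x - g y) + (f x - f y) * g y by ring]
    refine (abs_add_le _ _).trans ?_
    rw [abs_mul, abs_mul]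
    calc _ ≤ C * (D * dist x y) + C * dist x y * D := by
          gcongr
          exacts [hC1 x hx, hD2 x hx y hy, hC2 x hx y hy, hD1 y hy]
      _ = _ := by ring

theorem sub (hf : BddLipschitzOn s f) (hg : BddLipschitzOn s g) :
    BddLipschitzOn s fun x => f x - g x := by
  simpa [sub_eq_add_neg] using hf.add ((const (-1)).mul hg)

theorem sum {ι : Type*} (t : Finset ι) {F : ι → X → ℝ} (h : ∀ i ∈ t, BddLipschitzOn s (F i)) :
    BddLipschitzOn s fun x => ∑ i ∈ t, F i x := by
  classical
  induction t using Finset.induction_on with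
  | empty => simpa using const 0
  | insert a t ha ih =>
    simp only [Finset.sum_insert ha]
    exact (h a (by simp)).add (ih fun i hi => h i (by simp [hi]))

theorem exists_lipschitzOnWith_pi {ι : Type*} [Fintype ι] {F : X → ι → ℝ}
    (h : ∀ i, BddLipschitzOn s fun x => F x i) : ∃ L, LipschitzOnWith L F s := by
  choose C hC _ hC2 using h
  refine ⟨(∑ i, C i).toNNReal, LipschitzOnWith.of_dist_le_mul fun x hx y hy => ?_⟩
  have hsum : 0 ≤ ∑ i, C i := Finset.sum_nonneg fun i _ => hC i
  rw [Real.coe_toNNReal _ hsum]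
  refine (dist_pi_le_iff (by positivity)).2 fun i => ?_
  rw [Real.dist_eq]
  refine (hC2 i x hx y hy).trans ?_
  gcongr
  exact Finset.single_le_sum (fun j _ => hC j) (Finset.mem_univ i)

theorem fluxLimiter {Φ : ℝ → ℝ → ℝ} (hΦ : IsFluxLimiter Φ)
    (hf : BddLipschitzOn s f) (hg : BddLipschitzOn s g) (hf1 : ∀ x ∈ s, f x ∈ Icc (0:ℝ) 1)
    (hg1 : ∀ x ∈ s, g x ∈ Icc (0:ℝ) 1) : BddLipschitzOn s fun x => Φ (f x) (g x) := by
  obtain ⟨hΦ1, -, K, hK, hΦ3⟩ := hΦ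
  obtain ⟨C, -, -, hC2⟩ := hf
  obtain ⟨D, -, -, hD2⟩ := hg
  refine of_bounds (C := 1) (D := K * (C + D)) (fun x hx => ?_) fun x hx y hy => ?_
  · obtain ⟨h0, h1⟩ := hΦ1 _ (hf1 x hx) _ (hg1 x hx)
    rwa [abs_of_nonneg h0]
  · refine (hΦ3 _ (hf1 y hy) _ (hg1 y hy) _ (hf1 x hx) _ (hg1 x hx)).trans ?_
    rw [mul_assoc, add_mul]
    gcongr
    exacts [hC2 x hx y hy, hD2 x hx y hy]

theorem regularizer {ε : ℝ} {H : ℝ → ℝ} (hH : IsRegularizer ε H) (hf : BddLipschitzOn s f) :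
    BddLipschitzOn s fun x => H (f x) := by
  obtain ⟨hH1, -, -, K, hK, hH2⟩ := hH
  obtain ⟨C, -, -, hC2⟩ := hf
  refine of_bounds (C := 1) (D := K * C) (fun x _ => ?_) fun x hx y hy => ?_
  · rw [abs_of_nonneg (hH1 _).1]; exact (hH1 _).2
  · refine (hH2 _ _).trans ?_
    rw [mul_assoc]
    gcongr
    exact hC2 x hx y hy

theorem tableOfGames {n : ℕ} {A : Fin n → Fin n → Fin n → ℝ → ℝ} (hA : IsTableOfGames A)
    (hf : BddLipschitzOn s f) (hf1 : ∀ x ∈ s, f x ∈ Icc (0:ℝ) 1) (h k j : Fin n) :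
    BddLipschitzOn s fun x => A h k j (f x) := by
  obtain ⟨hA1, -, hA3⟩ := hA
  obtain ⟨K, hK, hA3⟩ := hA3 h k j
  obtain ⟨C, -, -, hC2⟩ := hf
  refine of_bounds (C := 1) (D := K * C) (fun x hx => ?_) fun x hx y hy => ?_
  · obtain ⟨h0, h1⟩ := hA1 h k j _ (hf1 x hx)
    rwa [abs_of_nonneg h0]
  · refine (hA3 _ (hf1 x hx) _ (hf1 y hy)).trans ?_
    rw [mul_assoc]
    gcongr
    exact hC2 x hx y hy

end BddLipschitzOn

theorem admissibleF.rhoF_mem {n : ℕ} {f : Fin n → ℝ} (hf : admissibleF f) :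
    rhoF f ∈ Icc (0:ℝ) 1 :=
  ⟨Finset.sum_nonneg fun j _ => (hf.1 j).1, hf.2⟩

section Lipschitz

variable {X : Type*} [PseudoMetricSpace X] {s : Set X} {n : ℕ} {f : X → Fin n → ℝ}

theorem bddLipschitzOn_rhoF (hf : ∀ j, BddLipschitzOn s fun x => f x j) :
    BddLipschitzOn s fun x => rhoF (f x) :=
  BddLipschitzOn.sum _ fun j _ => hf j

theorem bddLipschitzOn_fluxF (v : Fin n → ℝ) (hf : ∀ j, BddLipschitzOn s fun x => f x j) :
    BddLipschitzOn s fun x => fluxF v (f x) :=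
  BddLipschitzOn.sum _ fun j _ => (BddLipschitzOn.const (v j)).mul (hf j)

theorem bddLipschitzOn_gainF {A : Fin n → Fin n → Fin n → ℝ → ℝ} (hA : IsTableOfGames A)
    (η0 : ℝ) (hf : ∀ j, BddLipschitzOn s fun x => f x j) (hf1 : ∀ x ∈ s, admissibleF (f x))
    (j : Fin n) : BddLipschitzOn s fun x => gainF η0 A j (f x) := by
  have hρ := bddLipschitzOn_rhoF hf
  refine ((BddLipschitzOn.const η0).mul hρ).mul
    (BddLipschitzOn.sum _ fun h _ => BddLipschitzOn.sum _ fun k _ => ?_)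
  exact ((BddLipschitzOn.tableOfGames hA hρ (fun x hx => (hf1 x hx).rhoF_mem) h k j).mul
    (hf h)).mul (hf k)

theorem bddLipschitzOn_lossF (η0 : ℝ) (hf : ∀ j, BddLipschitzOn s fun x => f x j) :
    BddLipschitzOn s fun x => lossF η0 (f x) := by
  have hρ := bddLipschitzOn_rhoF hf
  simpa only [lossF, pow_two] using (BddLipschitzOn.const η0).mul (hρ.mul hρ)

end Lipschitz

theorem deltaC_mem {n : ℕ} (j : Fin n) : (deltaC j : ℝ) ∈ Icc (0:ℝ) 1 := by
  unfold deltaC; split_ifs <;> simp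

theorem IsSpeedLattice.mem_Icc {n : ℕ} {hn : 2 ≤ n} {v : Fin n → ℝ} (hv : IsSpeedLattice hn v)
    (j : Fin n) : v j ∈ Icc (0:ℝ) 1 := by
  obtain ⟨hm, h0, h1⟩ := hv
  rw [← h0, ← h1]
  exact ⟨hm.monotone (Fin.mk_le_of_le_val (Nat.zero_le _)),
    hm.monotone (Fin.le_def.2 (by simp; omega))⟩

theorem IsSpeedLattice.mul_deltaC_le {n : ℕ} {hn : 2 ≤ n} {v : Fin n → ℝ}
    (hv : IsSpeedLattice hn v) {i : Fin n} (hi : (i : ℕ) = 1) (j : Fin n) :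
    v i * deltaC j ≤ v j := by
  unfold deltaC
  split_ifs with h
  · simpa using (hv.mem_Icc j).1
  · rw [mul_one]
    exact hv.1.monotone (Fin.le_def.2 (by simp; omega))

theorem IsFluxLimiter.mul_le {Φ : ℝ → ℝ → ℝ} (hΦ : IsFluxLimiter Φ) {u w : ℝ}
    (hu : u ∈ Icc (0:ℝ) 1) (hw : w ∈ Icc (0:ℝ) 1) : Φ u w * u ≤ 1 - w := by
  by_cases h : 1 < u + w
  · exact hΦ.2.1 u hu w hw h
  · have := mul_le_of_le_one_left hu.1 (hΦ.1 u hu w hw).2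
    linarith

/-- The density offered to the outgoing road is at most one: when the minor incoming road is
open, the total incoming flux is below the first positive speed. -/
theorem incoming_density_mem {n : ℕ} {hn : 2 ≤ n} {v : Fin n → ℝ} (hv : IsSpeedLattice hn v)
    {ε : ℝ} {H : ℝ → ℝ} (hH : IsRegularizer ε H) {p : ℝ} (hp0 : 0 < p)
    {i : Fin n} (hi : (i : ℕ) = 1) (hpv : p ≤ v i) {f g : Fin n → ℝ} (hf : admissibleF f)
    (hg : admissibleF g) :
    ∑ k, deltaC k * (f k + H (p - (fluxF v f + fluxF v g)) * g k) ∈ Icc (0:ℝ) 1 := by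
  set c := H (p - (fluxF v f + fluxF v g)) with hc
  have hc01 : c ∈ Icc (0:ℝ) 1 := hH.1 _
  refine ⟨Finset.sum_nonneg fun k _ => mul_nonneg (deltaC_mem k).1
    (add_nonneg (hf.1 k).1 (mul_nonneg hc01.1 (hg.1 k).1)), ?_⟩
  by_cases hq : p - (fluxF v f + fluxF v g) ≤ 0
  · rw [hc, hH.2.1 _ hq]
    refine le_trans (Finset.sum_le_sum fun k _ => ?_) hf.2
    simpa using mul_le_of_le_one_left (hf.1 k).1 (deltaC_mem k).2
  · have hv1 : 0 < v i := hp0.trans_le hpv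
    refine le_of_mul_le_mul_left ?_ hv1
    rw [mul_one, Finset.mul_sum]
    calc _ ≤ ∑ k, (v k * f k + v k * g k) := by
          refine Finset.sum_le_sum fun k _ => ?_
          rw [← mul_assoc, ← mul_add]
          refine mul_le_mul (hv.mul_deltaC_le hi k) ?_ ?_ (hv.mem_Icc k).1
          · linarith [mul_le_of_le_one_left (hg.1 k).1 hc01.2]
          · exact add_nonneg (hf.1 k).1 (mul_nonneg hc01.1 (hg.1 k).1)
      _ = fluxF v f + fluxF v g := by rw [Finset.sum_add_distrib]; rfl
      _ ≤ _ := by linarith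

theorem gainF_nonneg {n : ℕ} {A : Fin n → Fin n → Fin n → ℝ → ℝ} (hA : IsTableOfGames A)
    {η0 : ℝ} (hη0 : 0 ≤ η0) {f : Fin n → ℝ} (hf : admissibleF f) (j : Fin n) :
    0 ≤ gainF η0 A j f := by
  refine mul_nonneg (mul_nonneg hη0 hf.rhoF_mem.1)
    (Finset.sum_nonneg fun h _ => Finset.sum_nonneg fun k _ => ?_)
  exact mul_nonneg (mul_nonneg (hA.1 h k j _ hf.rhoF_mem).1 (hf.1 h).1) (hf.1 k).1

theorem sum_gainF {n : ℕ} {A : Fin n → Fin n → Fin n → ℝ → ℝ} (hA : IsTableOfGames A)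
    (η0 : ℝ) {f : Fin n → ℝ} (hf : admissibleF f) :
    ∑ j, gainF η0 A j f = rhoF f * lossF η0 f := by
  have h1 : ∑ j, ∑ h, ∑ k, A h k j (rhoF f) * f h * f k = rhoF f * rhoF f := by
    rw [Finset.sum_comm]
    conv_rhs => rw [rhoF, Finset.sum_mul_sum]
    refine Finset.sum_congr rfl fun h _ => ?_
    rw [Finset.sum_comm]
    refine Finset.sum_congr rfl fun k _ => ?_
    simp_rw [mul_assoc]
    rw [← Finset.sum_mul, hA.2.1 h k _ hf.rhoF_mem, one_mul]
  simp only [gainF, ← Finset.mul_sum, h1, lossF]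
  ring

/-- A short explicit Euler step preserves admissibility provided the total inflow `∑ a j` does not
exceed the free space. -/
theorem admissibleF_euler_step {n : ℕ} {A : Fin n → Fin n → Fin n → ℝ → ℝ}
    (hA : IsTableOfGames A) {η0 : ℝ} (hη0 : 0 ≤ η0) {h : ℝ} (hh0 : 0 ≤ h)
    (hh : h * (1 + η0) ≤ 1) {f a c : Fin n → ℝ} (hf : admissibleF f) (ha : ∀ j, 0 ≤ a j)
    (hasum : ∑ j, a j ≤ 1 - rhoF f) (hc : ∀ j, c j ∈ Icc (0:ℝ) 1) :
    admissibleF fun j => f j + h * (a j - c j * f j + gainF η0 A j f - f j * lossF η0 f) := by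
  obtain ⟨hρ0, hρ1⟩ := hf.rhoF_mem
  have hloss : lossF η0 f ≤ η0 := by
    refine mul_le_of_le_one_right hη0 (pow_le_one₀ hρ0 hρ1)
  have hh1 : h ≤ 1 := by nlinarith
  have hnn : ∀ j, 0 ≤ f j + h * (a j - c j * f j + gainF η0 A j f - f j * lossF η0 f) := by
    intro j
    have h1 : h * (c j + lossF η0 f) ≤ 1 :=
      (mul_le_mul_of_nonneg_left (add_le_add (hc j).2 hloss) hh0).trans hh
    have h2 := mul_nonneg hh0 (add_nonneg (ha j) (gainF_nonneg hA hη0 hf j))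
    have h3 := mul_nonneg (hf.1 j).1 (sub_nonneg.2 h1)
    linarith
  have hcf : 0 ≤ ∑ j, c j * f j := Finset.sum_nonneg fun j _ => mul_nonneg (hc j).1 (hf.1 j).1
  have hsum : ∑ j, (f j + h * (a j - c j * f j + gainF η0 A j f - f j * lossF η0 f)) ≤ 1 := by
    rw [Finset.sum_add_distrib, ← Finset.mul_sum, Finset.sum_sub_distrib,
      Finset.sum_add_distrib, Finset.sum_sub_distrib, sum_gainF hA η0 hf, ← Finset.sum_mul]
    change rhoF f + h * (_ - _ + rhoF f * lossF η0 f - rhoF f * lossF η0 f) ≤ 1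
    have h4 := mul_le_mul_of_nonneg_left
      (show ∑ j, a j - ∑ j, c j * f j ≤ 1 - rhoF f by linarith) hh0
    have h5 := mul_le_mul_of_nonneg_right hh1 (sub_nonneg.2 hρ1)
    linarith
  exact ⟨fun j => ⟨hnn j, (Finset.single_le_sum (fun i _ => hnn i) (Finset.mem_univ j)).trans
    hsum⟩, hsum⟩

theorem isClosed_setOf_admissibleF (n : ℕ) : IsClosed {f : Fin n → ℝ | admissibleF f} := by
  have h : {f : Fin n → ℝ | admissibleF f} = Icc 0 1 ∩ {f | rhoF f ≤ 1} := by
    ext f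
    simp [admissibleF, Pi.le_def, forall_and]
  rw [h]
  refine isClosed_Icc.inter (isClosed_le ?_ continuous_const)
  unfold rhoF
  fun_prop

theorem convex_setOf_admissibleF (n : ℕ) : Convex ℝ {f : Fin n → ℝ | admissibleF f} := by
  have h : {f : Fin n → ℝ | admissibleF f} = Icc 0 1 ∩ {f | rhoF f ≤ 1} := by
    ext f
    simp [admissibleF, Pi.le_def, forall_and]
  rw [h]
  refine (convex_Icc _ _).inter (convex_halfSpace_le ⟨fun f g => ?_, fun c f => ?_⟩ 1)
  · simp [rhoF, Finset.sum_add_distrib]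
  · simp [rhoF, Finset.mul_sum]

/-- Boundary data of the 2-1 junction. -/
abbrev JunctionData (n : ℕ) : Type := (Fin n → ℝ) × (Fin n → ℝ) × ℝ

/-- States of the three roads of the 2-1 junction. -/
abbrev JunctionState (n : ℕ) : Type := (Fin n → ℝ) × (Fin n → ℝ) × (Fin n → ℝ)

def admissibleData (n : ℕ) : Set (JunctionData n) :=
  {f | admissibleF f} ×ˢ {f | admissibleF f} ×ˢ Icc 0 1

def admissibleStates (n : ℕ) : Set (JunctionState n) :=
  {f | admissibleF f} ×ˢ {f | admissibleF f} ×ˢ {f | admissibleF f}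

/-- One explicit Euler step of length `h` for the 2-1 junction with frozen boundary data. -/
noncomputable def junctionStep {n : ℕ} (v : Fin n → ℝ) (η0 : ℝ)
    (A : Fin n → Fin n → Fin n → ℝ → ℝ) (Φ : ℝ → ℝ → ℝ) (H : ℝ → ℝ) (p h : ℝ)
    (z : JunctionData n × JunctionState n) : JunctionState n :=
  (fun j => z.2.1 j + h * rhs21_1 v η0 A Φ H p (fun _ => z.1.1) (fun _ => z.2.1)
      (fun _ => z.2.2.1) (fun _ => z.2.2.2) j 0,
    fun j => z.2.2.1 j + h * rhs21_2 v η0 A Φ H p (fun _ => z.1.2.1) (fun _ => z.2.1)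
      (fun _ => z.2.2.1) (fun _ => z.2.2.2) j 0,
    fun j => z.2.2.2 j + h * rhs21_3 v η0 A Φ H p (fun _ => z.1.2.2) (fun _ => z.2.1)
      (fun _ => z.2.2.1) (fun _ => z.2.2.2) j 0)

theorem junctionStep_mem {n : ℕ} {hn : 2 ≤ n} {v : Fin n → ℝ} (hv : IsSpeedLattice hn v)
    {η0 : ℝ} (hη0 : 0 ≤ η0) {A : Fin n → Fin n → Fin n → ℝ → ℝ} (hA : IsTableOfGames A)
    {Φ : ℝ → ℝ → ℝ} (hΦ : IsFluxLimiter Φ) {ε : ℝ} {H : ℝ → ℝ} (hH : IsRegularizer ε H)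
    {p : ℝ} (hp0 : 0 < p) {i : Fin n} (hi : (i : ℕ) = 1) (hpv : p ≤ v i) {h : ℝ} (hh0 : 0 ≤ h)
    (hh : h * (1 + η0) ≤ 1) {z : JunctionData n × JunctionState n}
    (hz : z ∈ admissibleData n ×ˢ admissibleStates n) :
    junctionStep v η0 A Φ H p h z ∈ admissibleStates n := by
  obtain ⟨⟨b1, b2, β⟩, f1, f2, f3⟩ := z
  obtain ⟨⟨hb1, hb2, hβ⟩, hf1, hf2, hf3⟩ := hz
  simp only [mem_ofPred_eq] at hb1 hb2 hβ hf1 hf2 hf3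
  have hc : hcoef v H p (fun _ => f1) (fun _ => f2) 0 ∈ Icc (0:ℝ) 1 := hH.1 _
  have hu : ∑ k, deltaC k * (f1 k + hcoef v H p (fun _ => f1) (fun _ => f2) 0 * f2 k) ∈
    Icc (0:ℝ) 1 := incoming_density_mem hv hH hp0 hi hpv hf1 hf2
  have hφ : phi301 v Φ H p (fun _ => f1) (fun _ => f2) (fun _ => f3) 0 ∈ Icc (0:ℝ) 1 :=
    hΦ.1 _ hu _ hf3.rhoF_mem
  have hφu : phi301 v Φ H p (fun _ => f1) (fun _ => f2) (fun _ => f3) 0 *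
      ∑ k, deltaC k * (f1 k + hcoef v H p (fun _ => f1) (fun _ => f2) 0 * f2 k) ≤ 1 - rhoF f3 :=
    hΦ.mul_le hu hf3.rhoF_mem
  have inflow : ∀ b f : Fin n → ℝ, admissibleF b → admissibleF f →
      (∀ j, 0 ≤ v j * (Φ (∑ k, b k) (rhoF f) * b j)) ∧
      ∑ j, v j * (Φ (∑ k, b k) (rhoF f) * b j) ≤ 1 - rhoF f := by
    intro b f hb hf
    have h0 : ∀ j, 0 ≤ Φ (∑ k, b k) (rhoF f) * b j := fun j =>
      mul_nonneg (hΦ.1 _ hb.rhoF_mem _ hf.rhoF_mem).1 (hb.1 j).1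
    refine ⟨fun j => mul_nonneg (hv.mem_Icc j).1 (h0 j), le_trans (Finset.sum_le_sum fun j _ =>
      mul_le_of_le_one_left (h0 j) (hv.mem_Icc j).2) ?_⟩
    rw [← Finset.mul_sum]
    exact hΦ.mul_le hb.rhoF_mem hf.rhoF_mem
  have hmul : ∀ {a b : ℝ}, a ∈ Icc (0:ℝ) 1 → b ∈ Icc (0:ℝ) 1 → a * b ∈ Icc (0:ℝ) 1 :=
    fun ha hb => ⟨mul_nonneg ha.1 hb.1, mul_le_one₀ ha.2 hb.1 hb.2⟩
  simp only [junctionStep, rhs21_1, rhs21_2, rhs21_3]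
  generalize hcoef v H p (fun _ => f1) (fun _ => f2) 0 = c at *
  generalize phi301 v Φ H p (fun _ => f1) (fun _ => f2) (fun _ => f3) 0 = φ at *
  refine ⟨?_, ?_, ?_⟩
  · convert admissibleF_euler_step hA hη0 hh0 hh hf1 (inflow b1 f1 hb1 hf1).1
      (inflow b1 f1 hb1 hf1).2 (c := fun j => v j * φ) (fun j => hmul (hv.mem_Icc j) hφ) using 1
    simp only [mem_ofPred_eq]
    refine iff_of_eq (congrArg _ (funext fun j => ?_))
    ring
  · convert admissibleF_euler_step hA hη0 hh0 hh hf2 (inflow b2 f2 hb2 hf2).1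
      (inflow b2 f2 hb2 hf2).2 (c := fun j => v j * (c * φ))
      (fun j => hmul (hv.mem_Icc j) (hmul hc hφ)) using 1
    simp only [mem_ofPred_eq]
    refine iff_of_eq (congrArg _ (funext fun j => ?_))
    ring
  · have h0 : ∀ j, 0 ≤ φ * (deltaC j * (f1 j + c * f2 j)) := fun j =>
      mul_nonneg hφ.1 (mul_nonneg (deltaC_mem j).1
        (add_nonneg (hf1.1 j).1 (mul_nonneg hc.1 (hf2.1 j).1)))
    convert admissibleF_euler_step hA hη0 hh0 hh hf3
      (a := fun j => v j * (φ * (deltaC j * (f1 j + c * f2 j))))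
      (fun j => mul_nonneg (hv.mem_Icc j).1 (h0 j)) ?_ (c := fun j => v j * β)
      (fun j => hmul (hv.mem_Icc j) hβ) using 1
    · simp only [mem_ofPred_eq]
      refine iff_of_eq (congrArg _ (funext fun j => ?_))
      ring
    · refine le_trans (Finset.sum_le_sum fun j _ =>
        mul_le_of_le_one_left (h0 j) (hv.mem_Icc j).2) ?_
      rwa [← Finset.mul_sum]

theorem BddLipschitzOn.coord {n : ℕ} {X : Type*} [PseudoMetricSpace X] {s : Set X}
    {f : X → Fin n → ℝ} (hf : ∀ x y, dist (f x) (f y) ≤ dist x y) (hf1 : ∀ x ∈ s, admissibleF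
    (f x)) (j : Fin n) :
    BddLipschitzOn s fun x => f x j := by
  refine of_bounds (C := 1) (D := 1) (fun x hx => ?_) fun x _ y _ => ?_
  · obtain ⟨h0, h1⟩ := (hf1 x hx).1 j
    rwa [abs_of_nonneg h0]
  · rw [← Real.dist_eq]
    exact (dist_le_pi_dist _ _ j).trans (by simpa using hf x y)

theorem exists_lipschitzOnWith_junctionStep {n : ℕ} {hn : 2 ≤ n} {v : Fin n → ℝ}
    (hv : IsSpeedLattice hn v) (η0 : ℝ) {A : Fin n → Fin n → Fin n → ℝ → ℝ}
    (hA : IsTableOfGames A) {Φ : ℝ → ℝ → ℝ} (hΦ : IsFluxLimiter Φ) {ε : ℝ} {H : ℝ → ℝ}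
    (hH : IsRegularizer ε H) {p : ℝ} (hp0 : 0 < p) {i : Fin n} (hi : (i : ℕ) = 1) (hpv : p ≤ v i)
    (h : ℝ) :
    ∃ L, LipschitzOnWith L (junctionStep v η0 A Φ H p h)
      (admissibleData n ×ˢ admissibleStates n) := by
  set s : Set (JunctionData n × JunctionState n) := admissibleData n ×ˢ admissibleStates n
  have ab1 : ∀ z ∈ s, admissibleF z.1.1 := fun z hz => hz.1.1
  have ab2 : ∀ z ∈ s, admissibleF z.1.2.1 := fun z hz => hz.1.2.1
  have af1 : ∀ z ∈ s, admissibleF z.2.1 := fun z hz => hz.2.1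
  have af2 : ∀ z ∈ s, admissibleF z.2.2.1 := fun z hz => hz.2.2.1
  have af3 : ∀ z ∈ s, admissibleF z.2.2.2 := fun z hz => hz.2.2.2
  have hfst : ∀ {X Y : Type} [PseudoMetricSpace X] [PseudoMetricSpace Y] (x y : X × Y),
    dist x.1 y.1 ≤ dist x y := fun x y => le_max_left _ _
  have hsnd : ∀ {X Y : Type} [PseudoMetricSpace X] [PseudoMetricSpace Y] (x y : X × Y),
    dist x.2 y.2 ≤ dist x y := fun x y => le_max_right _ _
  have b1 := BddLipschitzOn.coord (fun x y => (hfst x.1 y.1).trans (hfst x y)) ab1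
  have b2 := BddLipschitzOn.coord
    (fun x y => (hfst x.1.2 y.1.2).trans ((hsnd x.1 y.1).trans (hfst x y))) ab2
  have f1 := BddLipschitzOn.coord (fun x y => (hfst x.2 y.2).trans (hsnd x y)) af1
  have f2 := BddLipschitzOn.coord
    (fun x y => (hfst x.2.2 y.2.2).trans ((hsnd x.2 y.2).trans (hsnd x y))) af2
  have f3 := BddLipschitzOn.coord
    (fun x y => (hsnd x.2.2 y.2.2).trans ((hsnd x.2 y.2).trans (hsnd x y))) af3
  have hβ : BddLipschitzOn s fun z => z.1.2.2 := by
    refine .of_bounds (C := 1) (D := 1) (fun z hz => ?_) fun x _ y _ => ?_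
    · obtain ⟨h0, h1⟩ : z.1.2.2 ∈ Icc (0:ℝ) 1 := hz.1.2.2
      rwa [abs_of_nonneg h0]
    · rw [← Real.dist_eq, one_mul]
      exact (hsnd x.1.2 y.1.2).trans ((hsnd x.1 y.1).trans (hfst x y))
  have hc : BddLipschitzOn s fun z =>
      hcoef v H p (fun _ => z.2.1) (fun _ => z.2.2.1) 0 :=
    .regularizer hH ((BddLipschitzOn.const p).sub
      ((bddLipschitzOn_fluxF v f1).add (bddLipschitzOn_fluxF v f2)))
  have hφ : BddLipschitzOn s fun z =>
      phi301 v Φ H p (fun _ => z.2.1) (fun _ => z.2.2.1) (fun _ => z.2.2.2) 0 :=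
    .fluxLimiter hΦ
      (.sum _ fun k _ => (BddLipschitzOn.const (deltaC k)).mul ((f1 k).add (hc.mul (f2 k))))
      (bddLipschitzOn_rhoF f3)
      (fun z hz => incoming_density_mem hv hH hp0 hi hpv (af1 z hz) (af2 z hz))
      (fun z hz => (af3 z hz).rhoF_mem)
  have hφ1 := BddLipschitzOn.fluxLimiter hΦ (bddLipschitzOn_rhoF b1) (bddLipschitzOn_rhoF f1)
    (fun z hz => (ab1 z hz).rhoF_mem) (fun z hz => (af1 z hz).rhoF_mem)
  have hφ2 := BddLipschitzOn.fluxLimiter hΦ (bddLipschitzOn_rhoF b2) (bddLipschitzOn_rhoF f2)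
    (fun z hz => (ab2 z hz).rhoF_mem) (fun z hz => (af2 z hz).rhoF_mem)
  obtain ⟨L1, h1⟩ := BddLipschitzOn.exists_lipschitzOnWith_pi (s := s)
    (F := fun z => (junctionStep v η0 A Φ H p h z).1) fun j =>
    (f1 j).add ((BddLipschitzOn.const h).mul
      ((((BddLipschitzOn.const (v j)).mul ((hφ1.mul (b1 j)).sub (hφ.mul (f1 j)))).add
        (bddLipschitzOn_gainF hA η0 f1 af1 j)).sub ((f1 j).mul (bddLipschitzOn_lossF η0 f1))))
  obtain ⟨L2, h2⟩ := BddLipschitzOn.exists_lipschitzOnWith_pi (s := s)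
    (F := fun z => (junctionStep v η0 A Φ H p h z).2.1) fun j =>
    (f2 j).add ((BddLipschitzOn.const h).mul
      ((((BddLipschitzOn.const (v j)).mul
        ((hφ2.mul (b2 j)).sub ((hc.mul hφ).mul (f2 j)))).add
        (bddLipschitzOn_gainF hA η0 f2 af2 j)).sub ((f2 j).mul (bddLipschitzOn_lossF η0 f2))))
  obtain ⟨L3, h3⟩ := BddLipschitzOn.exists_lipschitzOnWith_pi (s := s)
    (F := fun z => (junctionStep v η0 A Φ H p h z).2.2) fun j =>
    (f3 j).add ((BddLipschitzOn.const h).mul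
      ((((BddLipschitzOn.const (v j)).mul
        (((hφ.mul ((f1 j).add (hc.mul (f2 j)))).mul (BddLipschitzOn.const (deltaC j))).sub
          (hβ.mul (f3 j)))).add
        (bddLipschitzOn_gainF hA η0 f3 af3 j)).sub ((f3 j).mul (bddLipschitzOn_lossF η0 f3))))
  exact ⟨_, h1.prodMk (h2.prodMk h3)⟩

/-- Existence of a mild kinetic solution across the regularized 2-1 junction. -/
theorem existence_two_one_junction
    {n : ℕ} (hn : 2 ≤ n) (v : Fin n → ℝ) (hv : IsSpeedLattice hn v)
    (η0 : ℝ) (hη0 : 0 < η0)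
    (A : Fin n → Fin n → Fin n → ℝ → ℝ) (hA : IsTableOfGames A)
    (Φ : ℝ → ℝ → ℝ) (hΦ : IsFluxLimiter Φ)
    (ε : ℝ) (hε : 0 < ε) (H : ℝ → ℝ) (hH : IsRegularizer ε H)
    (p : ℝ) (hp0 : 0 < p) (hpv : p ≤ v ⟨1, by omega⟩)
    (T : ℝ) (hT : 0 < T)
    (φ1 φ2 φ3 : Fin n → ℝ) (fbar1 fbar2 : ℝ → Fin n → ℝ) (Φbar3 : ℝ → ℝ)
    (hdata : GoodData21 T φ1 φ2 φ3 fbar1 fbar2 Φbar3) :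
    ∃ f1 f2 f3 : ℝ → Fin n → ℝ,
      IsMildSol21 v η0 A Φ H p T φ1 φ2 φ3 fbar1 fbar2 Φbar3 f1 f2 f3 := by
  obtain ⟨hφ1, hφ2, hφ3, hb1c, hb1, hb2c, hb2, hβc, hβ⟩ := hdata
  have hη : 0 < 1 + η0 := by linarith
  have hmap : ∀ z ∈ admissibleData n ×ˢ admissibleStates n,
      junctionStep v η0 A Φ H p (1 + η0)⁻¹ z ∈ admissibleStates n := fun z hz =>
    junctionStep_mem hv hη0.le hA hΦ hH hp0 rfl hpv (inv_nonneg.2 hη.le)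
      (inv_mul_cancel₀ hη.ne').le hz
  obtain ⟨L, hL⟩ := exists_lipschitzOnWith_junctionStep hv η0 hA hΦ hH hp0 rfl hpv (1 + η0)⁻¹
  let y : ℝ → JunctionData n := fun t =>
    (fbar1 (projIcc 0 T hT.le t), fbar2 (projIcc 0 T hT.le t), Φbar3 (projIcc 0 T hT.le t))
  have hproj : Continuous fun t => (projIcc 0 T hT.le t : ℝ) :=
    continuous_subtype_val.comp continuous_projIcc
  have hprojm : ∀ t, (projIcc 0 T hT.le t : ℝ) ∈ Icc 0 T := fun t => Subtype.coe_prop _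
  have hy : Continuous y := (hb1c.comp_continuous hproj hprojm).prodMk
    ((hb2c.comp_continuous hproj hprojm).prodMk (hβc.comp_continuous hproj hprojm))
  have hyS : ∀ t, y t ∈ admissibleData n := fun t =>
    ⟨hb1 _ (hprojm t), hb2 _ (hprojm t), hβ _ (hprojm t)⟩
  have hyt : ∀ t ∈ Icc 0 T, y t = (fbar1 t, fbar2 t, Φbar3 t) := fun t ht => by
    simp only [y, projIcc_of_mem hT.le ht]
  have hclosed := isClosed_setOf_admissibleF n
  have hconvex := convex_setOf_admissibleF n
  obtain ⟨u, hu, huK, hueq⟩ := exists_relaxation_solution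
    (hclosed.prod (hclosed.prod hclosed)) (hconvex.prod (hconvex.prod hconvex)) hL hmap hy hyS
    (φ := (φ1, φ2, φ3)) ⟨hφ1, hφ2, hφ3⟩ hη hT.le
  have hint : ∀ t ∈ Icc 0 T, IntervalIntegrable
      (fun s => (1 + η0) • (junctionStep v η0 A Φ H p (1 + η0)⁻¹ (y s, u s) - u s))
      MeasureTheory.volume 0 t := by
    intro t ht
    refine ContinuousOn.intervalIntegrable ?_
    rw [uIcc_of_le ht.1]
    refine (ContinuousOn.sub ?_ hu.continuousOn).const_smul (1 + η0)
    exact hL.continuousOn.comp (hy.prodMk hu).continuousOn fun s hs =>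
      ⟨hyS s, huK s ⟨hs.1, hs.2.trans ht.2⟩⟩
  have coord : ∀ (P : JunctionState n →L[ℝ] ℝ) (r : ℝ → ℝ),
      (∀ s ∈ Icc 0 T, (1 + η0) *
        (P (junctionStep v η0 A Φ H p (1 + η0)⁻¹ ((fbar1 s, fbar2 s, Φbar3 s), u s)) - P (u s))
          = r s) →
      ∀ t ∈ Icc 0 T, P (u t) = P (φ1, φ2, φ3) + ∫ s in (0:ℝ)..t, r s := by
    intro P r hr t ht
    conv_lhs => rw [hueq t ht]
    rw [map_add, ← P.intervalIntegral_comp_comm (hint t ht)]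
    congr 1
    refine intervalIntegral.integral_congr fun s hs => ?_
    rw [uIcc_of_le ht.1] at hs
    have hsT : s ∈ Icc 0 T := ⟨hs.1, hs.2.trans ht.2⟩
    simp only [map_smul, map_sub, smul_eq_mul, hyt s hsT, hr s hsT]
  have cancel : ∀ a b : ℝ, (1 + η0) * (a + (1 + η0)⁻¹ * b - a) = b := fun a b => by
    field_simp
    ring
  refine ⟨fun t => (u t).1, fun t => (u t).2.1, fun t => (u t).2.2,
    (continuous_fst.comp hu).continuousOn,
    (continuous_fst.comp (continuous_snd.comp hu)).continuousOn,
    (continuous_snd.comp (continuous_snd.comp hu)).continuousOn,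
    fun t ht => ⟨(huK t ht).1, (huK t ht).2.1, (huK t ht).2.2⟩, fun t ht j => ?_,
    fun t ht j => ?_, fun t ht j => ?_⟩
  · exact coord ((ContinuousLinearMap.proj j).comp (ContinuousLinearMap.fst ℝ _ _)) _
      (fun s _ => cancel _ _) t ht
  · exact coord ((ContinuousLinearMap.proj j).comp
      ((ContinuousLinearMap.fst ℝ _ _).comp (ContinuousLinearMap.snd ℝ _ _))) _
      (fun s _ => cancel _ _) t ht
  · exact coord ((ContinuousLinearMap.proj j).comp
      ((ContinuousLinearMap.snd ℝ _ _).comp (ContinuousLinearMap.snd ℝ _ _))) _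
      (fun s _ => cancel _ _) t ht
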